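/- The quiver Hall-Littlewood series is multiplicative under concatenation: if (𝐢′, 𝐚′, μ′(•)) and (𝐢″, 𝐚″, μ″(•)) are two triples as above and (𝐢, 𝐚, μ(•)) is obtained by concatenating 𝐢 = 𝐢′𝐢″, 𝐚 = 𝐚′𝐚″, μ(•) = μ′(•)μ″(•), then χ^{𝐢,𝐚}_{μ(•)} = χ^{𝐢′,𝐚′}_{μ′(•)} ⋆ χ^{𝐢″,𝐚″}_{μ″(•)}, where the two factors are taken in disjoint sets of variables for the dimension vectors ν•(𝐢′,𝐚′) and ν•(𝐢″,𝐚″) (with ν^{(i)}(𝐢,𝐚) = Σ_{k : i_k = i} a_k) and the blocks of the concatenated data are those of 𝐢′,𝐚′ followed by those of 𝐢″,𝐚″. -/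

import Mathlib

open scoped BigOperators

namespace QKS

/-- The coordinates of `X• = ∏_i ℤ^{ν^{(i)}}`, indexed by their block `k` (with `i_k = i`)
and position `p` within the block.  The coordinates at vertex `i` are those with
`iseq k = i`, ordered lexicographically by `(k, p)`. -/
abbrev Coord (m : ℕ) (a : Fin m → ℕ) : Type := (k : Fin m) × Fin (a k)

/-- The (strict) order on coordinates: lexicographic by block, then position. -/
abbrev coordLT {m : ℕ} {a : Fin m → ℕ} (x y : Coord m a) : Prop :=
  x.1 < y.1 ∨ (x.1 = y.1 ∧ (x.2 : ℕ) < (y.2 : ℕ))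

variable {Q0 Q1 : Type} [Fintype Q0] [Fintype Q1] [DecidableEq Q0] [DecidableEq Q1]
variable {m : ℕ}

/-- The staircase `ρ• ∈ X•`: at each vertex, its coordinates are
`ν^{(i)} - 1, ν^{(i)} - 2, …, 1, 0` read in the order of the coordinates at that vertex;
equivalently, `ρ x` is the number of coordinates at the vertex of `x` that are greater
than `x`. -/
def rho (iseq : Fin m → Q0) (a : Fin m → ℕ) : Coord m a → ℤ := fun x =>
  ((Finset.univ.filter (fun y : Coord m a => iseq y.1 = iseq x.1 ∧ coordLT x y)).card : ℤ)

/-- The index set `R_{𝐢,𝐚}`: triples (arrow `b`, coordinate `(k,p)`, coordinate `(ℓ,q)`)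
with `k < ℓ`, `tb = i_k` and `hb = i_ℓ`. -/
abbrev RootSet (hd tl : Q1 → Q0) (iseq : Fin m → Q0) (a : Fin m → ℕ) : Type :=
  {z : Q1 × Coord m a × Coord m a //
    z.2.1.1 < z.2.2.1 ∧ tl z.1 = iseq z.2.1.1 ∧ hd z.1 = iseq z.2.2.1}

/-- `ᾱ = e(ℓ)_q − e(k)_p ∈ X•` for a root `α = α^b_{p,q}(k,ℓ)`. -/
def alphaBar {hd tl : Q1 → Q0} {iseq : Fin m → Q0} {a : Fin m → ℕ}
    (z : RootSet hd tl iseq a) : Coord m a → ℤ := fun x =>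
  (if x = z.1.2.2 then 1 else 0) - (if x = z.1.2.1 then 1 else 0)

/-- The group `S• = ∏_i S_{ν^{(i)}}`, realized as permutations of the coordinates
preserving the vertex. -/
abbrev VertexPerm (iseq : Fin m → Q0) (a : Fin m → ℕ) : Type :=
  {σ : Equiv.Perm (Coord m a) // ∀ x : Coord m a, iseq (σ x).1 = iseq x.1}

/-- The quiver Kostka-Shoji polynomial `𝒦^{𝐢,𝐚}_{λ•,μ(•)}(t_{Q₁})`, defined by the signed
sum over `w• ∈ S•` of, for each `w•`, the (finite) sum of the monomials
`∏_α t_α^{m(α)}` over all Kostant partitions `m : R_{𝐢,𝐚} → ℤ_{≥0}` with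
`Σ_α m(α) ᾱ = (w•)⁻¹(λ•+ρ•) − (μ•+ρ•)`. -/
noncomputable def KS (hd tl : Q1 → Q0) (iseq : Fin m → Q0) (a : Fin m → ℕ)
    (lam mu : Coord m a → ℤ) : MvPolynomial Q1 ℤ :=
  ∑ σ : VertexPerm iseq a,
    ((Equiv.Perm.sign σ.1 : ℤˣ) : ℤ) •
      ∑ᶠ f : {f : RootSet hd tl iseq a → ℕ //
          ∀ x : Coord m a,
            (∑ α : RootSet hd tl iseq a, (f α : ℤ) * alphaBar α x)
              = (lam (σ.1 x) + rho iseq a (σ.1 x)) - (mu x + rho iseq a x)},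
        ∏ α : RootSet hd tl iseq a, MvPolynomial.X α.1.1 ^ f.1 α

/-- `μ(•)` is a sequence of weakly decreasing vectors `μ(k) ∈ ℤ^{a_k}`. -/
def BlockDecreasing {a : Fin m → ℕ} (mu : Coord m a → ℤ) : Prop :=
  ∀ (k : Fin m) (p q : Fin (a k)), p ≤ q → mu ⟨k, q⟩ ≤ mu ⟨k, p⟩

/-- `λ•` is a tuple of weakly decreasing vectors `λ^{(i)} ∈ ℤ^{ν^{(i)}}`: weakly decreasing
along the coordinates of each vertex. -/
def VertexDecreasing (iseq : Fin m → Q0) {a : Fin m → ℕ} (lam : Coord m a → ℤ) : Prop :=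
  ∀ x y : Coord m a, iseq x.1 = iseq y.1 → coordLT x y → lam y ≤ lam x

end QKS

open scoped BigOperators

namespace Shuffle

noncomputable section

/-- The field of rational functions in the variables indexed by `V`: the fraction field of
the multivariate polynomial ring.  Laurent polynomials in the variables `X v` are viewed
inside this field, and the geometric series `(1 - t·x/y)⁻¹` is the honest inverse here. -/
abbrev FF (V : Type) : Type := FractionRing (MvPolynomial V ℚ)

/-- The variable `X v`, viewed in the rational function field. -/
def xv {V : Type} (v : V) : FF V := algebraMap (MvPolynomial V ℚ) (FF V) (MvPolynomial.X v)

/-- The action of a permutation of the variables on the rational function field,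
by renaming variables. -/
def act {V : Type} (σ : Equiv.Perm V) : FF V →+* FF V :=
  IsFractionRing.lift (g := (algebraMap (MvPolynomial V ℚ) (FF V)).comp
      (MvPolynomial.rename σ : MvPolynomial V ℚ →ₐ[ℚ] MvPolynomial V ℚ).toRingHom)
    ((IsFractionRing.injective (MvPolynomial V ℚ) (FF V)).comp
      (MvPolynomial.rename_injective σ σ.injective))

variable {X Q0 Q1 : Type} [Fintype X] [DecidableEq X] [Fintype Q0] [DecidableEq Q0]
  [Fintype Q1] [DecidableEq Q1]

/-- The `x`-variable indexed by `x : X`, inside the field of rational functions in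
the `x`-variables and the arrow variables. -/
def xx (Q1 : Type) (x : X) : FF (X ⊕ Q1) := xv (Sum.inl x)

/-- The arrow variable `t_b`. -/
def tt (X : Type) (b : Q1) : FF (X ⊕ Q1) := xv (Sum.inr b)

/-- Extension of a permutation of the `x`-variables by the identity on the arrow
variables. -/
def permExt (Q1 : Type) (σ : Equiv.Perm X) : Equiv.Perm (X ⊕ Q1) :=
  Equiv.sumCongr σ (Equiv.refl Q1)

/-- The monomial `x^β` with integer exponents. -/
def xmon (Q1 : Type) (β : X → ℤ) : FF (X ⊕ Q1) := ∏ x : X, (xx Q1 x) ^ (β x)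

/-- The staircase exponent for the variables in `S`: each variable `x ∈ S` gets the number
of variables in `S` at the same vertex that come after it (so at each vertex the variables
of `S` receive `ν - 1, ν - 2, …, 1, 0` in their listed order). -/
def rhoS (vert : X → Q0) (lt : X → X → Prop) [DecidableRel lt] (S : Finset X) : X → ℤ :=
  fun x => if x ∈ S then ((S.filter (fun y => vert y = vert x ∧ lt x y)).card : ℤ) else 0

/-- The antisymmetrizer `J• = Σ (−1)^{w•} w•` over the permutations of the variables in `S`
preserving the vertex of each variable (and fixing all other variables). -/
def Jsym (vert : X → Q0) (S : Finset X) (f : FF (X ⊕ Q1)) : FF (X ⊕ Q1) :=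
  ∑ σ ∈ Finset.univ.filter (fun σ : Equiv.Perm X =>
      (∀ x, vert (σ x) = vert x) ∧ ∀ x ∉ S, σ x = x),
    ((Equiv.Perm.sign σ : ℤˣ) : ℤ) • act (permExt Q1 σ) f

/-- The Demazure symmetrizer `D_{w₀•}(f) = J•(x^{ρ•})⁻¹ · J•(x^{ρ•} f)` over the variables
in `S`, symmetrizing at each vertex. -/
def Dem (vert : X → Q0) (lt : X → X → Prop) [DecidableRel lt] (S : Finset X)
    (f : FF (X ⊕ Q1)) : FF (X ⊕ Q1) :=
  (Jsym vert S (xmon Q1 (rhoS vert lt S)))⁻¹ * Jsym vert S (xmon Q1 (rhoS vert lt S) * f)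

/-- The subring of Laurent polynomials over `ℤ[t_b^{±1} : b ∈ Q₁]` in the `x`-variables
belonging to `S`. -/
def LaurentIn (Q1 : Type) [Fintype Q1] (S : Finset X) : Subring (FF (X ⊕ Q1)) :=
  Subring.closure
    ((fun x : X => xx Q1 x) '' ↑S ∪ (fun x : X => (xx Q1 x)⁻¹) '' ↑S
      ∪ Set.range (tt X (Q1 := Q1)) ∪ Set.range (fun b : Q1 => (tt X b)⁻¹))

/-- `f` is symmetric in the variables of `S` at each vertex. -/
def SymmOn (Q1 : Type) (vert : X → Q0) (S : Finset X) (f : FF (X ⊕ Q1)) : Prop :=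
  ∀ σ : Equiv.Perm X, (∀ x, vert (σ x) = vert x) → (∀ x ∉ S, σ x = x) →
    act (permExt Q1 σ) f = f

/-- The shuffle product `f * g` of `f` (in the variables of `A`) and `g` (in the variables
of `B`): `D_{w₀•}(f · g · ∏_b ∏_{y ∈ B, vert y = tb} ∏_{x ∈ A, vert x = hb}
(1 − t_b y/x))`. -/
def starMul (vert : X → Q0) (hd tl : Q1 → Q0) (lt : X → X → Prop) [DecidableRel lt]
    (A B : Finset X) (f g : FF (X ⊕ Q1)) : FF (X ⊕ Q1) :=
  Dem vert lt (A ∪ B) (f * g *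
    ∏ b : Q1, ∏ y ∈ B.filter (fun y => vert y = tl b), ∏ x ∈ A.filter (fun x => vert x = hd b),
      (1 - tt X b * xx Q1 y / xx Q1 x))

/-- The shuffle product `f ⋆ g` of `f` (in the variables of `A`) and `g` (in the variables
of `B`): `D_{w₀•}(f · g · ∏_b ∏_{x ∈ A, vert x = tb} ∏_{y ∈ B, vert y = hb}
(1 − t_b x/y)⁻¹)`. -/
def starGeom (vert : X → Q0) (hd tl : Q1 → Q0) (lt : X → X → Prop) [DecidableRel lt]
    (A B : Finset X) (f g : FF (X ⊕ Q1)) : FF (X ⊕ Q1) :=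
  Dem vert lt (A ∪ B) (f * g *
    ∏ b : Q1, ∏ x ∈ A.filter (fun x => vert x = tl b), ∏ y ∈ B.filter (fun y => vert y = hd b),
      (1 - tt X b * xx Q1 x / xx Q1 y)⁻¹)

end

end Shuffle

namespace QHL

open QKS Shuffle

noncomputable section

instance {m : ℕ} {a : Fin m → ℕ} : DecidableRel (fun x y : Coord m a => coordLT x y) :=
  fun _ _ => inferInstanceAs (Decidable (_ ∨ _))

variable {Q0 Q1 : Type} [Fintype Q0] [DecidableEq Q0] [Fintype Q1] [DecidableEq Q1]
variable {m : ℕ} {a : Fin m → ℕ}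

/-- The block `x(k)` of variables. -/
def blkF (m : ℕ) (a : Fin m → ℕ) (k : ℕ) : Finset (Coord m a) :=
  Finset.univ.filter (fun x => (x.1 : ℕ) = k)

/-- The variables of the blocks before block `k`. -/
def headF (m : ℕ) (a : Fin m → ℕ) (k : ℕ) : Finset (Coord m a) :=
  Finset.univ.filter (fun x => (x.1 : ℕ) < k)

/-- The Schur (Laurent) polynomial `s_{μ(k)}[x(k)] = J(x(k)^{μ(k)+ρ})/J(x(k)^ρ)` in the
variables of block `k`, realized as the Demazure symmetrizer of the monomial `x(k)^{μ(k)}`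
over the block-`k` variables. -/
def schurBlk (Q1 : Type) [Fintype Q1] [DecidableEq Q1] (iseq : Fin m → Q0)
    (mu : Coord m a → ℤ) (k : ℕ) : FF (Coord m a ⊕ Q1) :=
  Dem (fun x => iseq x.1) (fun x y => coordLT x y) (blkF m a k)
    (xmon Q1 (fun x => if (x.1 : ℕ) = k then mu x else 0))

/-- The iterated (left to right) shuffle product
`s_{μ(1)}[x(1)] ⋆ s_{μ(2)}[x(2)] ⋆ ⋯ ⋆ s_{μ(k)}[x(k)]` of the Schur polynomials of the
first `k` blocks. -/
def starAllL (hd tl : Q1 → Q0) (iseq : Fin m → Q0) (mu : Coord m a → ℤ) :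
    ℕ → FF (Coord m a ⊕ Q1)
  | 0 => 1
  | (k + 1) =>
      starGeom (fun x => iseq x.1) hd tl (fun x y => coordLT x y) (headF m a k) (blkF m a k)
        (starAllL hd tl iseq mu k) (schurBlk Q1 iseq mu k)

/-- The factor `B_{𝐢,𝐚}`, restricted to the variables in `S`:
`∏_{k<ℓ} ∏_{b : i_k → i_ℓ} ∏_{y ∈ x(k), z ∈ x(ℓ)} (1 − t_b y/z)⁻¹`. -/
def BfieldS (hd tl : Q1 → Q0) (iseq : Fin m → Q0) (a : Fin m → ℕ)
    (S : Finset (Coord m a)) : FF (Coord m a ⊕ Q1) :=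
  ∏ x ∈ S, ∏ y ∈ S, ∏ b : Q1,
    if x.1 < y.1 ∧ tl b = iseq x.1 ∧ hd b = iseq y.1
    then (1 - tt (Coord m a) b * xx Q1 x / xx Q1 y)⁻¹ else 1

/-- The quiver Hall-Littlewood series `χ^{𝐢,𝐚}_{μ(•)} = D_{w₀•}(x^{μ•} B_{𝐢,𝐚})`
(in the rational-function model), for the data restricted to the variables in `S`. -/
def chiF (hd tl : Q1 → Q0) (iseq : Fin m → Q0) (a : Fin m → ℕ) (mu : Coord m a → ℤ)
    (S : Finset (Coord m a)) : FF (Coord m a ⊕ Q1) :=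
  Dem (fun x => iseq x.1) (fun x y => coordLT x y) S
    (xmon Q1 (fun x => if x ∈ S then mu x else 0) * BfieldS hd tl iseq a S)

end

end QHL


namespace QHL

open QKS Shuffle

noncomputable section

/-- The variables of the blocks from block `k` on. -/
def tailF (m : ℕ) (a : Fin m → ℕ) (k : ℕ) : Finset (Coord m a) :=
  Finset.univ.filter (fun x => k ≤ (x.1 : ℕ))

end

end QHL

namespace Shuffle

noncomputable section

section Action

variable {V : Type}

lemma act_algebraMap (σ : Equiv.Perm V) (p : MvPolynomial V ℚ) :
    act σ (algebraMap _ (FF V) p) = algebraMap _ (FF V) (MvPolynomial.rename σ p) := by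
  simp [act]

lemma act_xv (σ : Equiv.Perm V) (v : V) : act σ (xv v) = xv (σ v) := by
  simp [xv, act_algebraMap]

lemma act_mul (σ τ : Equiv.Perm V) (f : FF V) : act (σ * τ) f = act σ (act τ f) := by
  have h : act (σ * τ) = (act σ).comp (act τ) := by
    apply IsLocalization.ringHom_ext (nonZeroDivisors (MvPolynomial V ℚ))
    ext p
    · simp
    · simp [act_algebraMap]
  rw [h, RingHom.comp_apply]

end Action

variable {X Q0 Q1 : Type}

lemma act_permExt_mul (σ τ : Equiv.Perm X) (f : FF (X ⊕ Q1)) :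
    act (permExt Q1 (σ * τ)) f = act (permExt Q1 σ) (act (permExt Q1 τ) f) := by
  rw [← act_mul]
  congr 2
  ext x
  cases x <;> rfl

lemma act_permExt_xx (σ : Equiv.Perm X) (x : X) :
    act (permExt Q1 σ) (xx Q1 x) = xx Q1 (σ x) := by
  simp [xx, act_xv, permExt]

lemma act_permExt_tt (σ : Equiv.Perm X) (b : Q1) :
    act (permExt Q1 σ) (tt X b) = tt X b := by
  simp [tt, act_xv, permExt]

lemma xx_ne_zero (x : X) : xx Q1 x ≠ 0 := by
  simp [xx, xv]

lemma xmon_add [Fintype X] (β γ : X → ℤ) : xmon Q1 (β + γ) = xmon Q1 β * xmon Q1 γ := by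
  simp only [xmon, Pi.add_apply, zpow_add₀ (xx_ne_zero _), Finset.prod_mul_distrib]

lemma act_permExt_xmon [Fintype X] (σ : Equiv.Perm X) (β : X → ℤ) :
    act (permExt Q1 σ) (xmon Q1 β) = xmon Q1 (β ∘ σ.symm) := by
  simp only [xmon, map_prod, map_zpow₀, act_permExt_xx]
  exact Fintype.prod_equiv σ _ _ (by simp)

lemma act_permExt_xmon_eq_self [Fintype X] {σ : Equiv.Perm X} {β : X → ℤ}
    (h : ∀ x, β (σ x) = β x) : act (permExt Q1 σ) (xmon Q1 β) = xmon Q1 β := by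
  rw [act_permExt_xmon]
  congr 1
  ext x
  simpa using (h (σ.symm x)).symm

lemma xmon_natCast [Fintype X] (d : X →₀ ℕ) :
    xmon Q1 (fun x => (d x : ℤ)) = algebraMap (MvPolynomial (X ⊕ Q1) ℚ) (FF (X ⊕ Q1))
      (MvPolynomial.rename Sum.inl (MvPolynomial.monomial d 1)) := by
  rw [MvPolynomial.monomial_eq, Finsupp.prod_fintype _ _ (by simp)]
  simp [xmon, xx, xv]

/-- The vertex-preserving permutations of the variables which fix everything outside `S`. -/
def vertexStabilizer (vert : X → Q0) (S : Finset X) : Subgroup (Equiv.Perm X) where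
  carrier := {σ | (∀ x, vert (σ x) = vert x) ∧ ∀ x ∉ S, σ x = x}
  one_mem' := by simp
  mul_mem' := by
    rintro σ τ ⟨h1, h2⟩ ⟨h3, h4⟩
    refine ⟨fun x => by simp [h1, h3], fun x hx => by simp [h4 x hx, h2 x hx]⟩
  inv_mem' := by
    rintro σ ⟨h1, h2⟩
    refine ⟨fun x => by simpa using (h1 (σ⁻¹ x)).symm, fun x hx => ?_⟩
    rw [Equiv.Perm.inv_eq_iff_eq, h2 x hx]

variable {vert : X → Q0} {A B S : Finset X} {σ τ : Equiv.Perm X}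

lemma mem_vertexStabilizer :
    σ ∈ vertexStabilizer vert S ↔ (∀ x, vert (σ x) = vert x) ∧ ∀ x ∉ S, σ x = x :=
  Iff.rfl

lemma vertexStabilizer_mono (h : A ⊆ S) : vertexStabilizer vert A ≤ vertexStabilizer vert S :=
  fun _ hσ => ⟨hσ.1, fun x hx => hσ.2 x fun hA => hx (h hA)⟩

lemma apply_mem_iff (hσ : σ ∈ vertexStabilizer vert S) (x : X) : σ x ∈ S ↔ x ∈ S := by
  constructor
  · intro h
    by_contra hx
    exact hx (hσ.2 x hx ▸ h)
  · intro h
    by_contra hx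
    exact hx (by rwa [σ.injective (hσ.2 _ hx)])

lemma commute_of_disjoint (h : Disjoint A B) (hσ : σ ∈ vertexStabilizer vert A)
    (hτ : τ ∈ vertexStabilizer vert B) : σ * τ = τ * σ := by
  refine Equiv.Perm.Disjoint.commute fun x => ?_
  by_cases hx : x ∈ A
  · exact Or.inr (hτ.2 x (Finset.disjoint_left.mp h hx))
  · exact Or.inl (hσ.2 x hx)

lemma symmOn_iff {f : FF (X ⊕ Q1)} :
    SymmOn Q1 vert S f ↔ ∀ σ ∈ vertexStabilizer vert S, act (permExt Q1 σ) f = f :=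
  ⟨fun h σ hσ => h σ hσ.1 hσ.2, fun h σ h1 h2 => h σ ⟨h1, h2⟩⟩

lemma SymmOn.mul {f g : FF (X ⊕ Q1)} (hf : SymmOn Q1 vert S f) (hg : SymmOn Q1 vert S g) :
    SymmOn Q1 vert S (f * g) := fun σ h1 h2 => by
  rw [map_mul, hf σ h1 h2, hg σ h1 h2]

lemma symmOn_xmon [Fintype X] {β : X → ℤ}
    (h : ∀ σ ∈ vertexStabilizer vert S, ∀ x, β (σ x) = β x) : SymmOn Q1 vert S (xmon Q1 β) :=
  symmOn_iff.mpr fun σ hσ => act_permExt_xmon_eq_self (h σ hσ)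

lemma symmOn_xmon_of_disjoint [Fintype X] {β : X → ℤ} (h : ∀ x ∈ S, β x = 0) :
    SymmOn Q1 vert S (xmon Q1 β) := by
  refine symmOn_xmon fun σ hσ x => ?_
  by_cases hx : x ∈ S
  · rw [h x hx, h _ ((apply_mem_iff hσ x).mpr hx)]
  · rw [hσ.2 x hx]

lemma symmOn_prod_filter [DecidableEq Q0] {ι : Type} [Fintype ι] (vert : X → Q0) (S : Finset X) (p : ι → Q0)
    (F : ι → X → FF (X ⊕ Q1))
    (h : ∀ σ ∈ vertexStabilizer vert S, ∀ b, ∀ x ∈ S,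
      act (permExt Q1 σ) (F b x) = F b (σ x)) :
    SymmOn Q1 vert S (∏ b, ∏ x ∈ S.filter (fun x => vert x = p b), F b x) := by
  refine symmOn_iff.mpr fun σ hσ => ?_
  rw [map_prod]
  refine Finset.prod_congr rfl fun b _ => ?_
  rw [map_prod]
  refine Finset.prod_equiv σ (fun x => ?_) fun x hx => h σ hσ b x (Finset.mem_filter.mp hx).1
  simp [apply_mem_iff hσ, hσ.1 x]

lemma symmOn_cross_left [DecidableEq Q0] [Fintype Q1] (hd tl : Q1 → Q0)
    (h : Disjoint A B) :
    SymmOn Q1 vert A (∏ b : Q1, ∏ x ∈ A.filter (fun x => vert x = tl b),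
      ∏ y ∈ B.filter (fun y => vert y = hd b), (1 - tt X b * xx Q1 x / xx Q1 y)⁻¹) := by
  refine symmOn_prod_filter vert A tl _ fun σ hσ b x _ => ?_
  rw [map_prod]
  refine Finset.prod_congr rfl fun y hy => ?_
  have hy' : y ∉ A := Finset.disjoint_right.mp h (Finset.mem_filter.mp hy).1
  simp only [map_inv₀, map_sub, map_one, map_div₀, map_mul, act_permExt_tt, act_permExt_xx,
    hσ.2 y hy']

lemma symmOn_cross_right [DecidableEq Q0] [Fintype Q1] (hd tl : Q1 → Q0)
    (h : Disjoint A B) :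
    SymmOn Q1 vert B (∏ b : Q1, ∏ x ∈ A.filter (fun x => vert x = tl b),
      ∏ y ∈ B.filter (fun y => vert y = hd b), (1 - tt X b * xx Q1 x / xx Q1 y)⁻¹) := by
  simp_rw [Finset.prod_comm (s := A.filter _)]
  refine symmOn_prod_filter vert B hd _ fun σ hσ b y _ => ?_
  rw [map_prod]
  refine Finset.prod_congr rfl fun x hx => ?_
  have hx' : x ∉ B := Finset.disjoint_left.mp h (Finset.mem_filter.mp hx).1
  simp only [map_inv₀, map_sub, map_one, map_div₀, map_mul, act_permExt_tt, act_permExt_xx,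
    hσ.2 x hx']

variable [Fintype X] [DecidableEq X] [DecidableEq Q0]

lemma mem_filter_iff : σ ∈ Finset.univ.filter (fun σ : Equiv.Perm X =>
      (∀ x, vert (σ x) = vert x) ∧ ∀ x ∉ S, σ x = x) ↔ σ ∈ vertexStabilizer vert S := by
  simp [mem_vertexStabilizer]

lemma Jsym_act (hτ : τ ∈ vertexStabilizer vert S) (f : FF (X ⊕ Q1)) :
    Jsym vert S (act (permExt Q1 τ) f) = ((Equiv.Perm.sign τ : ℤˣ) : ℤ) • Jsym vert S f := by
  rw [Jsym, Jsym, zsmul_eq_mul, Finset.mul_sum]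
  refine Finset.sum_bij (fun σ _ => σ * τ) ?_ ?_ ?_ ?_
  · intro σ hσ
    rw [mem_filter_iff] at hσ ⊢
    exact mul_mem hσ hτ
  · intro _ _ _ _ h
    exact mul_right_cancel h
  · intro σ hσ
    rw [mem_filter_iff] at hσ
    exact ⟨σ * τ⁻¹, mem_filter_iff.mpr (mul_mem hσ (inv_mem hτ)), by simp⟩
  · intro σ _
    rw [← zsmul_eq_mul, act_permExt_mul, smul_smul, Equiv.Perm.sign_mul, Units.val_mul, mul_left_comm,
      Int.units_coe_mul_self, mul_one]

lemma act_Jsym (hτ : τ ∈ vertexStabilizer vert S) (f : FF (X ⊕ Q1)) :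
    act (permExt Q1 τ) (Jsym vert S f) = ((Equiv.Perm.sign τ : ℤˣ) : ℤ) • Jsym vert S f := by
  rw [Jsym, map_sum, zsmul_eq_mul, Finset.mul_sum]
  refine Finset.sum_bij (fun σ _ => τ * σ) ?_ ?_ ?_ ?_
  · intro σ hσ
    rw [mem_filter_iff] at hσ ⊢
    exact mul_mem hτ hσ
  · intro _ _ _ _ h
    exact mul_left_cancel h
  · intro σ hσ
    rw [mem_filter_iff] at hσ
    exact ⟨τ⁻¹ * σ, mem_filter_iff.mpr (mul_mem (inv_mem hτ) hσ), by simp⟩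
  · intro σ _
    rw [← zsmul_eq_mul, act_permExt_mul, smul_smul, Equiv.Perm.sign_mul, Units.val_mul, ← mul_assoc,
      Int.units_coe_mul_self, one_mul, map_zsmul]

lemma act_Jsym_of_disjoint (h : Disjoint A B) (hτ : τ ∈ vertexStabilizer vert A)
    (f : FF (X ⊕ Q1)) :
    act (permExt Q1 τ) (Jsym vert B f) = Jsym vert B (act (permExt Q1 τ) f) := by
  rw [Jsym, Jsym, map_sum]
  refine Finset.sum_congr rfl fun σ hσ => ?_
  rw [mem_filter_iff] at hσ
  rw [map_zsmul, ← act_permExt_mul, ← act_permExt_mul, commute_of_disjoint h hτ hσ]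

lemma Jsym_mul_of_symmOn (f : FF (X ⊕ Q1)) {k : FF (X ⊕ Q1)} (hk : SymmOn Q1 vert S k) :
    Jsym vert S (f * k) = Jsym vert S f * k := by
  rw [Jsym, Jsym, Finset.sum_mul]
  refine Finset.sum_congr rfl fun σ hσ => ?_
  rw [mem_filter_iff] at hσ
  rw [map_mul, symmOn_iff.mp hk σ hσ, smul_mul_assoc]

/-- Two functions with the same antisymmetrization over `A ⊆ S` have the same
antisymmetrization over `S`. -/
lemma Jsym_eq_of_subset (hAS : A ⊆ S) {f g : FF (X ⊕ Q1)}
    (h : Jsym vert A f = Jsym vert A g) : Jsym vert S f = Jsym vert S g := by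
  have key (f : FF (X ⊕ Q1)) : Jsym vert S (Jsym vert A f) =
      (Finset.univ.filter (fun σ : Equiv.Perm X =>
        (∀ x, vert (σ x) = vert x) ∧ ∀ x ∉ A, σ x = x)).card • Jsym vert S f := by
    have hsum (s : Finset (Equiv.Perm X)) (c : Equiv.Perm X → ℤ)
        (F : Equiv.Perm X → FF (X ⊕ Q1)) :
        Jsym vert S (∑ σ ∈ s, c σ • F σ) = ∑ σ ∈ s, c σ • Jsym vert S (F σ) := by
      simp only [Jsym, map_sum, map_zsmul, Finset.smul_sum]
      rw [Finset.sum_comm]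
      exact Finset.sum_congr rfl fun _ _ => Finset.sum_congr rfl fun _ _ => smul_comm _ _ _
    conv_lhs => rw [Jsym.eq_def vert A f, hsum]
    refine Finset.sum_eq_card_nsmul fun σ hσ => ?_
    rw [mem_filter_iff] at hσ
    rw [Jsym_act (vertexStabilizer_mono hAS hσ), smul_smul, Int.units_coe_mul_self, one_smul]
  have hcard : (Finset.univ.filter (fun σ : Equiv.Perm X =>
        (∀ x, vert (σ x) = vert x) ∧ ∀ x ∉ A, σ x = x)).card ≠ 0 :=
    Finset.card_ne_zero_of_mem (mem_filter_iff.mpr (one_mem (vertexStabilizer vert A)))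
  have := key f
  rw [h, key g] at this
  have hc : ((Finset.univ.filter (fun σ : Equiv.Perm X =>
        (∀ x, vert (σ x) = vert x) ∧ ∀ x ∉ A, σ x = x)).card : FF (X ⊕ Q1)) ≠ 0 := by
    rw [← map_natCast (algebraMap (MvPolynomial (X ⊕ Q1) ℚ) (FF (X ⊕ Q1)))]
    simpa using hcard
  rw [nsmul_eq_mul, nsmul_eq_mul] at this
  exact (mul_left_cancel₀ hc this).symm

variable {lt : X → X → Prop} [DecidableRel lt]

lemma symmOn_Dem (f : FF (X ⊕ Q1)) : SymmOn Q1 vert S (Dem vert lt S f) := by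
  refine symmOn_iff.mpr fun σ hσ => ?_
  rw [Dem, map_mul, map_inv₀, act_Jsym hσ, act_Jsym hσ]
  rcases Int.units_eq_one_or (Equiv.Perm.sign σ) with h | h <;> simp [h, inv_neg]

lemma symmOn_Dem_of_disjoint (h : Disjoint A B) {f : FF (X ⊕ Q1)} (hf : SymmOn Q1 vert A f) :
    SymmOn Q1 vert A (Dem vert lt B f) := by
  have hrho : SymmOn Q1 vert A (xmon Q1 (rhoS vert lt B)) :=
    symmOn_xmon_of_disjoint fun x hx => if_neg (Finset.disjoint_left.mp h hx)
  refine symmOn_iff.mpr fun σ hσ => ?_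
  rw [Dem, map_mul, map_inv₀, act_Jsym_of_disjoint h hσ, act_Jsym_of_disjoint h hσ,
    symmOn_iff.mp (hrho.mul hf) σ hσ, symmOn_iff.mp hrho σ hσ]

/-- The Vandermonde denominator does not vanish. -/
lemma Jsym_xmon_rhoS_ne_zero [IsStrictTotalOrder X lt] :
    Jsym vert S (xmon Q1 (rhoS vert lt S)) ≠ 0 := by
  let d : X →₀ ℕ := Finsupp.equivFunOnFinite.symm fun x =>
    if x ∈ S then (S.filter (fun y => vert y = vert x ∧ lt x y)).card else 0
  have hd : rhoS vert lt S = fun x => (d x : ℤ) := by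
    ext x
    by_cases hx : x ∈ S <;> simp [rhoS, d, hx]
  have hlt {x y : X} (hx : x ∈ S) (hy : y ∈ S) (hv : vert x = vert y) (hxy : lt x y) :
      d y < d x := by
    simp only [d, Finsupp.equivFunOnFinite_symm_apply_apply, hx, hy, if_true]
    refine Finset.card_lt_card ⟨fun z hz => ?_, fun hsub => ?_⟩
    · simp only [Finset.mem_filter] at hz ⊢
      exact ⟨hz.1, hz.2.1.trans hv.symm, trans_of lt hxy hz.2.2⟩
    · have := hsub (Finset.mem_filter.mpr ⟨hy, hv.symm, hxy⟩)
      exact irrefl_of lt y (Finset.mem_filter.mp this).2.2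
  have hinj {σ : Equiv.Perm X} (hσ : σ ∈ vertexStabilizer vert S)
      (h : d.mapDomain σ = d) : σ = 1 := by
    ext x
    by_cases hx : x ∈ S
    · have hdx : d (σ x) = d x := by
        conv_lhs => rw [← h, Finsupp.mapDomain_apply σ.injective]
      have hσx := (apply_mem_iff hσ x).mpr hx
      rcases trichotomous_of lt (σ x) x with h1 | h1 | h1
      · exact absurd (hlt hσx hx (hσ.1 x) h1) (by omega)
      · exact h1
      · exact absurd (hlt hx hσx (hσ.1 x).symm h1) (by omega)
    · exact hσ.2 x hx
  have hJ : Jsym vert S (xmon Q1 (rhoS vert lt S)) =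
      algebraMap (MvPolynomial (X ⊕ Q1) ℚ) (FF (X ⊕ Q1)) (MvPolynomial.rename Sum.inl
        (∑ σ ∈ Finset.univ.filter (fun σ : Equiv.Perm X =>
          (∀ x, vert (σ x) = vert x) ∧ ∀ x ∉ S, σ x = x),
          ((Equiv.Perm.sign σ : ℤˣ) : ℤ) • MvPolynomial.monomial (d.mapDomain σ) (1 : ℚ))) := by
    rw [Jsym, map_sum, map_sum]
    refine Finset.sum_congr rfl fun σ _ => ?_
    rw [map_zsmul, map_zsmul, hd, xmon_natCast, act_algebraMap, MvPolynomial.rename_rename,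
      ← MvPolynomial.rename_monomial, MvPolynomial.rename_rename]
    rfl
  rw [hJ]
  intro h0
  rw [map_eq_zero_iff _ (IsFractionRing.injective (MvPolynomial (X ⊕ Q1) ℚ) (FF (X ⊕ Q1))),
    map_eq_zero_iff _ (MvPolynomial.rename_injective _ Sum.inl_injective)] at h0
  have hc := congrArg (MvPolynomial.coeff d) h0
  rw [MvPolynomial.coeff_sum, Finset.sum_eq_single (1 : Equiv.Perm X)] at hc
  · simp at hc
  · intro σ hσ hne
    rw [mem_filter_iff] at hσ
    rw [← MvPolynomial.coeffAddMonoidHom_apply, map_zsmul, MvPolynomial.coeffAddMonoidHom_apply,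
      MvPolynomial.coeff_monomial, if_neg fun h => hne (hinj hσ h), smul_zero]
  · exact fun h => absurd (mem_filter_iff.mpr (one_mem (vertexStabilizer vert S))) h

/-- A Demazure symmetrizer over `A ⊆ S` is absorbed by the one over `S`, as soon as the two
staircases differ by an exponent that is symmetric on `A`. -/
lemma Dem_Dem_mul [IsStrictTotalOrder X lt] (hAS : A ⊆ S)
    (hrho : ∀ σ ∈ vertexStabilizer vert A, ∀ x,
      (rhoS vert lt S - rhoS vert lt A) (σ x) = (rhoS vert lt S - rhoS vert lt A) x)
    (f : FF (X ⊕ Q1)) {k : FF (X ⊕ Q1)} (hk : SymmOn Q1 vert A k) :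
    Dem vert lt S (Dem vert lt A f * k) = Dem vert lt S (f * k) := by
  have hc := (symmOn_xmon (Q1 := Q1) hrho).mul hk
  rw [Dem.eq_def vert lt S, Dem.eq_def vert lt S]
  congr 1
  apply Jsym_eq_of_subset hAS
  have hsplit : xmon Q1 (rhoS vert lt S) =
      xmon Q1 (rhoS vert lt A) * xmon Q1 (rhoS vert lt S - rhoS vert lt A) := by
    rw [← xmon_add, add_sub_cancel]
  set c := xmon Q1 (rhoS vert lt S - rhoS vert lt A)
  rw [hsplit,
    show xmon Q1 (rhoS vert lt A) * c * (Dem vert lt A f * k) =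
      xmon Q1 (rhoS vert lt A) * (Dem vert lt A f * (c * k)) by ring,
    show xmon Q1 (rhoS vert lt A) * c * (f * k) =
      xmon Q1 (rhoS vert lt A) * f * (c * k) by ring,
    Jsym_mul_of_symmOn _ ((symmOn_Dem f).mul hc), Jsym_mul_of_symmOn _ hc, Dem,
    ← mul_assoc, mul_inv_cancel_left₀ Jsym_xmon_rhoS_ne_zero]

/-- Symmetrizing first over an initial part `A` and the complementary final part `B` of the
variables does not change the total symmetrization. -/
lemma Dem_union_Dem_mul_Dem [IsStrictTotalOrder X lt] (hAB : ∀ x ∈ A, ∀ y ∈ B, lt x y)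
    {f g h : FF (X ⊕ Q1)} (hf : SymmOn Q1 vert B f) (hg : SymmOn Q1 vert A g)
    (hhA : SymmOn Q1 vert A h) (hhB : SymmOn Q1 vert B h) :
    Dem vert lt (A ∪ B) (Dem vert lt A f * Dem vert lt B g * h) =
      Dem vert lt (A ∪ B) (f * g * h) := by
  have hdisj : Disjoint A B := Finset.disjoint_left.mpr fun x hA hB =>
    irrefl_of lt x (hAB x hA x hB)
  have hrhoA : ∀ σ ∈ vertexStabilizer vert A, ∀ x,
      (rhoS vert lt (A ∪ B) - rhoS vert lt A) (σ x) =
        (rhoS vert lt (A ∪ B) - rhoS vert lt A) x := by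
    have hA (x : X) (hx : x ∈ A) : (rhoS vert lt (A ∪ B) - rhoS vert lt A) x =
        ((B.filter (fun y => vert y = vert x)).card : ℤ) := by
      have : B.filter (fun y => vert y = vert x ∧ lt x y) = B.filter (fun y => vert y = vert x) :=
        Finset.filter_congr fun y hy => and_iff_left (hAB x hx y hy)
      simp only [Pi.sub_apply, rhoS, hx, Finset.mem_union, true_or, if_true]
      rw [Finset.filter_union, Finset.card_union_of_disjoint
        (Finset.disjoint_filter_filter hdisj), this]
      push_cast
      ring
    intro σ hσ x
    by_cases hx : x ∈ A
    · rw [hA x hx, hA _ ((apply_mem_iff hσ x).mpr hx), hσ.1 x]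
    · rw [hσ.2 x hx]
  have hrhoB : ∀ σ ∈ vertexStabilizer vert B, ∀ x,
      (rhoS vert lt (A ∪ B) - rhoS vert lt B) (σ x) =
        (rhoS vert lt (A ∪ B) - rhoS vert lt B) x := by
    have hB (x : X) (hx : x ∈ B) : (rhoS vert lt (A ∪ B) - rhoS vert lt B) x = 0 := by
      have : A.filter (fun y => vert y = vert x ∧ lt x y) = ∅ :=
        Finset.filter_eq_empty_iff.mpr fun y hy h => asymm_of lt h.2 (hAB y hy x hx)
      simp only [Pi.sub_apply, rhoS, hx, Finset.mem_union, or_true, if_true]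
      rw [Finset.filter_union, this, Finset.empty_union, sub_self]
    intro σ hσ x
    by_cases hx : x ∈ B
    · rw [hB x hx, hB _ ((apply_mem_iff hσ x).mpr hx)]
    · rw [hσ.2 x hx]
  rw [mul_assoc, Dem_Dem_mul Finset.subset_union_left hrhoA _
      ((symmOn_Dem_of_disjoint hdisj hg).mul hhA),
    mul_left_comm, Dem_Dem_mul Finset.subset_union_right hrhoB _ (hf.mul hhB),
    mul_left_comm, mul_assoc]

end

end Shuffle

namespace QHL

open QKS Shuffle

noncomputable section

variable {Q0 Q1 : Type} [DecidableEq Q0] [Fintype Q1] {m : ℕ} {a : Fin m → ℕ}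

instance : IsStrictTotalOrder (Coord m a) (fun x y => coordLT x y) where
  irrefl x h := by
    rcases h with h | h
    · exact lt_irrefl _ h
    · exact lt_irrefl _ h.2
  trans := by
    rintro ⟨i, p⟩ ⟨j, q⟩ ⟨k, r⟩ h1 h2
    simp only [coordLT, Fin.lt_def, Fin.ext_iff] at h1 h2 ⊢
    omega
  trichotomous := by
    rintro ⟨i, p⟩ ⟨j, q⟩ h1 h2
    simp only [coordLT, not_or, not_and, not_lt] at h1 h2
    obtain rfl : i = j := le_antisymm h2.1 h1.1
    obtain rfl : p = q := Fin.ext (le_antisymm (h2.2 rfl) (h1.2 rfl))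
    rfl

lemma symmOn_BfieldS_of_disjoint (hd tl : Q1 → Q0) (iseq : Fin m → Q0)
    {A B : Finset (Coord m a)} (h : Disjoint A B) :
    SymmOn Q1 (fun x => iseq x.1) A (BfieldS hd tl iseq a B) := by
  refine symmOn_iff.mpr fun σ hσ => ?_
  simp only [BfieldS, map_prod]
  refine Finset.prod_congr rfl fun x hx => Finset.prod_congr rfl fun y hy =>
    Finset.prod_congr rfl fun b _ => ?_
  split_ifs
  · simp only [map_inv₀, map_sub, map_one, map_div₀, map_mul, act_permExt_tt, act_permExt_xx,
      hσ.2 x (Finset.disjoint_right.mp h hx), hσ.2 y (Finset.disjoint_right.mp h hy)]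
  · exact map_one _

lemma BfieldS_union (hd tl : Q1 → Q0) (iseq : Fin m → Q0) {A B : Finset (Coord m a)}
    (hAB : ∀ x ∈ A, ∀ y ∈ B, x.1 < y.1) :
    BfieldS hd tl iseq a (A ∪ B) = BfieldS hd tl iseq a A * BfieldS hd tl iseq a B *
      ∏ b : Q1, ∏ x ∈ A.filter (fun x => iseq x.1 = tl b),
        ∏ y ∈ B.filter (fun y => iseq y.1 = hd b),
          (1 - tt (Coord m a) b * xx Q1 x / xx Q1 y)⁻¹ := by
  have hdisj : Disjoint A B := Finset.disjoint_left.mpr fun x hA hB =>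
    lt_irrefl _ (hAB x hA x hB)
  have hAB' : (∏ x ∈ A, ∏ y ∈ B, ∏ b : Q1,
      if x.1 < y.1 ∧ tl b = iseq x.1 ∧ hd b = iseq y.1
      then (1 - tt (Coord m a) b * xx Q1 x / xx Q1 y)⁻¹ else 1) =
      ∏ b : Q1, ∏ x ∈ A.filter (fun x => iseq x.1 = tl b),
        ∏ y ∈ B.filter (fun y => iseq y.1 = hd b),
          (1 - tt (Coord m a) b * xx Q1 x / xx Q1 y)⁻¹ := by
    simp_rw [Finset.prod_comm (s := B) (t := Finset.univ)]
    rw [Finset.prod_comm]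
    refine Finset.prod_congr rfl fun b _ => ?_
    rw [Finset.prod_filter]
    refine Finset.prod_congr rfl fun x hx => ?_
    split_ifs with hxb
    · rw [Finset.prod_filter]
      refine Finset.prod_congr rfl fun y hy => ?_
      simp [hAB x hx y hy, hxb, eq_comm]
    · exact Finset.prod_eq_one fun y _ => if_neg fun h => hxb h.2.1.symm
  have hBA : (∏ x ∈ B, ∏ y ∈ A, ∏ b : Q1,
      if x.1 < y.1 ∧ tl b = iseq x.1 ∧ hd b = iseq y.1
      then (1 - tt (Coord m a) b * xx Q1 x / xx Q1 y)⁻¹ else 1) = 1 :=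
    Finset.prod_eq_one fun x hx => Finset.prod_eq_one fun y hy => Finset.prod_eq_one fun b _ =>
      if_neg fun h => lt_asymm h.1 (hAB y hy x hx)
  simp only [BfieldS, Finset.prod_union hdisj, Finset.prod_mul_distrib]
  rw [hAB', hBA]
  ring

/-- Multiplicativity of the quiver Hall-Littlewood series for a set of variables split into an
initial and a final part. -/
lemma chiF_union [DecidableEq Q1] [Fintype Q0] (hd tl : Q1 → Q0) (iseq : Fin m → Q0)
    (mu : Coord m a → ℤ) {A B : Finset (Coord m a)} (hAB : ∀ x ∈ A, ∀ y ∈ B, x.1 < y.1) :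
    chiF hd tl iseq a mu (A ∪ B) =
      starGeom (fun x => iseq x.1) hd tl (fun x y => coordLT x y) A B
        (chiF hd tl iseq a mu A) (chiF hd tl iseq a mu B) := by
  have hdisj : Disjoint A B := Finset.disjoint_left.mpr fun x hA hB =>
    lt_irrefl _ (hAB x hA x hB)
  have hmon : xmon Q1 (fun x => if x ∈ A ∪ B then mu x else 0) =
      xmon Q1 (fun x => if x ∈ A then mu x else 0) *
        xmon Q1 (fun x => if x ∈ B then mu x else 0) := by
    rw [← xmon_add]
    congr 1
    ext x
    by_cases hA : x ∈ A
    · simp [hA, Finset.disjoint_left.mp hdisj hA]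
    · simp [hA]
  rw [starGeom, chiF, chiF, chiF, Dem_union_Dem_mul_Dem (fun x hx y hy => Or.inl (hAB x hx y hy))
    ((symmOn_xmon_of_disjoint fun x hx => if_neg (Finset.disjoint_right.mp hdisj hx)).mul
      (symmOn_BfieldS_of_disjoint hd tl iseq hdisj.symm))
    ((symmOn_xmon_of_disjoint fun x hx => if_neg (Finset.disjoint_left.mp hdisj hx)).mul
      (symmOn_BfieldS_of_disjoint hd tl iseq hdisj))
    (symmOn_cross_left hd tl hdisj) (symmOn_cross_right hd tl hdisj),
    BfieldS_union hd tl iseq hAB, hmon]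
  congr 1
  ring

end

end QHL

open QKS Shuffle QHL in
/-- the quiver Hall-Littlewood series is multiplicative under concatenation
of the data: if `(𝐢, 𝐚, μ(•))` is the concatenation of `(𝐢′, 𝐚′, μ′(•))` (the first `m′`
blocks) and `(𝐢″, 𝐚″, μ″(•))` (the last `m″` blocks), then
`χ^{𝐢,𝐚}_{μ(•)} = χ^{𝐢′,𝐚′}_{μ′(•)} ⋆ χ^{𝐢″,𝐚″}_{μ″(•)}`. -/
theorem stmt_14
    (Q0 Q1 : Type) [Fintype Q0] [DecidableEq Q0] [Fintype Q1] [DecidableEq Q1]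
    (hd tl : Q1 → Q0)
    (m' m'' : ℕ) (iseq : Fin (m' + m'') → Q0) (a : Fin (m' + m'') → ℕ) (ha : ∀ k, 0 < a k)
    (mu : Coord (m' + m'') a → ℤ) (hmu : BlockDecreasing mu) :
    chiF hd tl iseq a mu Finset.univ
      = starGeom (fun x => iseq x.1) hd tl (fun x y => coordLT x y)
          (headF (m' + m'') a m') (tailF (m' + m'') a m')
          (chiF hd tl iseq a mu (headF (m' + m'') a m'))
          (chiF hd tl iseq a mu (tailF (m' + m'') a m')) := by
  rw [← chiF_union hd tl iseq mu fun x hx y hy => ?_]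
  · congr 1
    ext x
    simp [headF, tailF, lt_or_ge]
  · simp only [headF, tailF, Finset.mem_filter] at hx hy
    exact Fin.lt_def.mpr (hx.2.trans_le hy.2)
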